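/- arXiv:1306.4619 — 2 statements merged into one kernel-verified Lean document; each statement's English description precedes it below -/
import Mathlib

section
/- Assume 𝕎 has a finite positive limit L = lim_{c→∞} 𝕎(c). Then lim_{c→∞} [ w^{(q)}(c;0) − q∫_b^c 𝕎(c−y) w^{(q)}(y;0) dy ] / 𝕎(c) = (1 − α W^{(q)}(0)) ℤ^{(q)}(b) − α∫₀^b W^{(q)′}(z) ℤ^{(q)}(b−z) dz, and this quantity equals Z^{(q)}(b) − α W^{(q)}(b). -/
open MeasureTheory Set Filter Topology

/-- The Laplace exponent of a spectrally negative Lévy process with triplet `(γ, σ, ν)`. -/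
noncomputable def levyPsi (γ σ : ℝ) (ν : Measure ℝ) (l : ℝ) : ℝ :=
  γ * l + σ ^ 2 / 2 * l ^ 2 +
    ∫ z in Set.Ioi (0 : ℝ),
      (Real.exp (-l * z) - 1 +
        l * z * Set.indicator (Set.Ioc (0 : ℝ) 1) (fun _ => (1 : ℝ)) z) ∂ν

/-- The right-inverse `Φ(q) = sup {λ ≥ 0 : f(λ) = q}` of a Laplace exponent `f`. -/
noncomputable def levyPhi (f : ℝ → ℝ) (q : ℝ) : ℝ :=
  sSup {l : ℝ | 0 ≤ l ∧ f l = q}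

/-- `∫₀¹ z ν(dz)`, as an extended nonnegative real. -/
noncomputable def smallJumpMass (ν : Measure ℝ) : ENNReal :=
  ∫⁻ z in Set.Ioc (0 : ℝ) 1, ENNReal.ofReal z ∂ν

/-- `ν` is a Lévy measure on `(0,∞)`: it charges only `(0,∞)` and
integrates `min(1, z²)`. -/
def IsLevyMeasure (ν : Measure ℝ) : Prop :=
  ν (Set.Iic 0) = 0 ∧ (∫⁻ z in Set.Ioi (0 : ℝ), ENNReal.ofReal (min 1 (z ^ 2)) ∂ν) ≠ ⊤

/-- The process is not the negative of a subordinator: `σ > 0`, or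
`∫₀¹ z ν(dz) = ∞`, or `γ + ∫₀¹ z ν(dz) > 0`. -/
def NonDegenerate (γ σ : ℝ) (ν : Measure ℝ) : Prop :=
  0 < σ ∨ smallJumpMass ν = ⊤ ∨ 0 < γ + (smallJumpMass ν).toReal

/-- `W` is the `q`-scale function associated with the Laplace exponent `f`,
where `Φq` is the value of the right-inverse of `f` at `q`. -/
def IsScaleFunction (f : ℝ → ℝ) (Φq q : ℝ) (W : ℝ → ℝ) : Prop :=
  (∀ x < 0, W x = 0) ∧ ContinuousOn W (Set.Ici 0) ∧ MonotoneOn W (Set.Ici 0) ∧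
    ∀ l, Φq < l → (∫ y in Set.Ioi (0 : ℝ), Real.exp (-l * y) * W y) = 1 / (f l - q)

/-- Admissibility of the refraction parameter `α`: `α > 0`, and when the paths
have bounded variation (`σ = 0` and `∫₀¹ z ν(dz) < ∞`), `α` is smaller than the
drift `c = γ + ∫₀¹ z ν(dz)`. -/
def AlphaAdmissible (γ σ α : ℝ) (ν : Measure ℝ) : Prop :=
  0 < α ∧ ((σ = 0 ∧ smallJumpMass ν ≠ ⊤) → α < γ + (smallJumpMass ν).toReal)

/-- The function `w^{(q)}(·;0)` associated with the refracted process: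
`w^{(q)}(x;0) = W^{(q)}(x) + α·1_{{x ≥ b}}∫_b^x 𝕎^{(q)}(x-y) W^{(q)′}(y) dy`. -/
noncomputable def refractedW (α b : ℝ) (W W' Wαq : ℝ → ℝ) (x : ℝ) : ℝ :=
  W x + α * (if b ≤ x then ∫ y in b..x, Wαq (x - y) * W' y else 0)

/-- The function `z^{(q)}(·;0)` associated with the refracted process:
`z^{(q)}(x;0) = Z^{(q)}(x) + αq·1_{{x ≥ b}}∫_b^x 𝕎^{(q)}(x-y) W^{(q)}(y) dy`,
where `Z^{(q)}(x) = 1 + q∫₀ˣ W^{(q)}(y) dy`. -/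
noncomputable def refractedZ (α b q : ℝ) (W Wαq : ℝ → ℝ) (x : ℝ) : ℝ :=
  (1 + q * ∫ y in (0:ℝ)..x, W y) +
    α * q * (if b ≤ x then ∫ y in b..x, Wαq (x - y) * W y else 0)

/-- A function on `(0,∞)` whose exponential moments vanish along an arithmetic progression
vanishes almost everywhere. -/
theorem ae_eq_zero_of_laplace_eq_zero {f : ℝ → ℝ} {l : ℝ}
    (hf : IntegrableOn (fun y => Real.exp (-l * y) * f y) (Ioi 0))
    (h : ∀ n : ℕ, ∫ y in Ioi (0 : ℝ), Real.exp (-(l + n) * y) * f y = 0) :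
    ∀ᵐ y, y ∈ Ioi (0 : ℝ) → f y = 0 := by
  set g : ℝ → ℝ := fun y => Real.exp (-l * y) * f y with hg
  have hbdd : ∀ {k : ℝ → ℝ} (C : ℝ), Measurable k → (∀ y ∈ Ioi (0 : ℝ), |k y| ≤ C) →
      IntegrableOn (fun y => k y * g y) (Ioi 0) := fun {k} C hk hC =>
    Integrable.bdd_mul (c := C) hf hk.aestronglyMeasurable
      ((ae_restrict_iff' measurableSet_Ioi).2 (ae_of_all _ hC))
  have hexp01 : ∀ y ∈ Ioi (0 : ℝ), Real.exp (-y) ∈ Icc (0 : ℝ) 1 := fun y hy =>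
    ⟨(Real.exp_pos _).le, Real.exp_le_one_iff.2 (by simpa using le_of_lt hy)⟩
  have hpolyint : ∀ p : Polynomial ℝ,
      IntegrableOn (fun y => p.eval (Real.exp (-y)) * g y) (Ioi 0) := by
    intro p
    obtain ⟨C, hC⟩ := isCompact_Icc.exists_bound_of_continuousOn
      (s := Icc (0 : ℝ) 1) p.continuous.continuousOn
    exact hbdd C (p.continuous.measurable.comp (by fun_prop)) fun y hy => hC _ (hexp01 y hy)
  have hpoly : ∀ p : Polynomial ℝ, ∫ y in Ioi (0 : ℝ), p.eval (Real.exp (-y)) * g y = 0 := by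
    intro p
    induction p using Polynomial.induction_on' with
    | add p r hp hr =>
      simp only [Polynomial.eval_add, add_mul]
      rw [integral_add (hpolyint p) (hpolyint r), hp, hr, add_zero]
    | monomial n a =>
      have : ∀ y : ℝ, (Polynomial.monomial n a).eval (Real.exp (-y)) * g y
          = a * (Real.exp (-(l + n) * y) * f y) := by
        intro y
        rw [Polynomial.eval_monomial, ← Real.exp_nat_mul, hg]
        have : Real.exp (-(l + n) * y) = Real.exp (n * -y) * Real.exp (-l * y) := by
          rw [← Real.exp_add]; congr 1; ring
        rw [this]; ring
      simp only [this]
      rw [integral_const_mul, h n, mul_zero]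
  have hcont : ∀ φ : ℝ → ℝ, ContinuousOn φ (Icc 0 1) → Measurable φ →
      ∫ y in Ioi (0 : ℝ), φ (Real.exp (-y)) * g y = 0 := by
    intro φ hφ hφm
    obtain ⟨C, hC⟩ := isCompact_Icc.exists_bound_of_continuousOn hφ
    have hφi : IntegrableOn (fun y => φ (Real.exp (-y)) * g y) (Ioi 0) :=
      hbdd C (hφm.comp (by fun_prop)) fun y hy => hC _ (hexp01 y hy)
    set M := ∫ y in Ioi (0 : ℝ), |g y| with hM
    have hM0 : 0 ≤ M := integral_nonneg fun _ => abs_nonneg _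
    have key : ∀ ε > 0, ‖∫ y in Ioi (0 : ℝ), φ (Real.exp (-y)) * g y‖ ≤ ε * M := by
      intro ε hε
      obtain ⟨p, hp⟩ := exists_polynomial_near_of_continuousOn 0 1 φ hφ ε hε
      have e : ∫ y in Ioi (0 : ℝ), φ (Real.exp (-y)) * g y
          = ∫ y in Ioi (0 : ℝ), (φ (Real.exp (-y)) * g y - p.eval (Real.exp (-y)) * g y) := by
        rw [integral_sub hφi (hpolyint p), hpoly p, sub_zero]
      rw [e, hM, ← integral_const_mul]
      refine norm_integral_le_of_norm_le (hf.abs.const_mul ε) ?_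
      refine (ae_restrict_iff' measurableSet_Ioi).2 (ae_of_all _ fun y hy => ?_)
      rw [← sub_mul, norm_mul, Real.norm_eq_abs, Real.norm_eq_abs, abs_sub_comm]
      exact mul_le_mul_of_nonneg_right (hp _ (hexp01 y hy)).le (abs_nonneg _)
    refine norm_le_zero_iff.1 (le_of_forall_pos_le_add fun ε hε => ?_)
    refine (key (ε / (M + 1)) (by positivity)).trans ?_
    rw [zero_add, div_mul_eq_mul_div, div_le_iff₀ (by positivity)]
    nlinarith
  have hgz : ∀ᵐ y, y ∈ Ioi (0 : ℝ) → g y = 0 := by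
    refine isOpen_Ioi.ae_eq_zero_of_integral_contDiff_smul_eq_zero hf.locallyIntegrableOn ?_
    intro k hk hkc hks
    have hk0 : ∀ y ≤ 0, k y = 0 := fun y hy => by
      by_contra hne
      exact absurd (hks (subset_tsupport _ hne)) (not_lt.2 hy)
    have hφ : Continuous fun u => k (-Real.log u) := by
      rw [continuous_iff_continuousAt]
      intro u
      by_cases hu : u = 0
      · subst hu
        rw [continuousAt_iff_punctured_nhds]
        have h1 : Tendsto (fun u => -Real.log u) (𝓝[≠] 0) atTop :=
          tendsto_neg_atBot_atTop.comp Real.tendsto_log_nhdsNE_zero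
        have h2 : Tendsto k atTop (𝓝 0) := by
          have := hkc.is_zero_at_infty
          exact this.mono_left (atTop_le_cocompact)
        simpa [hk0 0 le_rfl, Function.comp_def] using h2.comp h1
      · exact hk.continuous.continuousAt.comp (Real.continuousAt_log hu).neg
    have := hcont _ hφ.continuousOn hφ.measurable
    simp only [Real.log_exp, neg_neg] at this
    rw [← this, ← integral_indicator measurableSet_Ioi]
    refine integral_congr_ae (ae_of_all _ fun y => ?_)
    by_cases hy : y ∈ Ioi (0 : ℝ)
    · simp [indicator_of_mem hy]
    · simp [indicator_of_notMem hy, hk0 y (not_lt.1 hy)]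
  filter_upwards [hgz] with y hy hy0
  exact (mul_eq_zero.1 (hy hy0)).resolve_left (Real.exp_pos _).ne'

theorem IsLevyMeasure.measure_Ioi_ne_top {ν : Measure ℝ} (hν : IsLevyMeasure ν) {δ : ℝ}
    (hδ : 0 < δ) : ν (Ioi δ) ≠ ⊤ := by
  have hc : ENNReal.ofReal (min 1 (δ ^ 2)) ≠ 0 := by
    simp only [ne_eq, ENNReal.ofReal_eq_zero, not_le]; positivity
  have h : ENNReal.ofReal (min 1 (δ ^ 2)) * ν (Ioi δ) ≤
      ∫⁻ z in Ioi (0 : ℝ), ENNReal.ofReal (min 1 (z ^ 2)) ∂ν := by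
    rw [← setLIntegral_const]
    refine (setLIntegral_mono' measurableSet_Ioi fun z hz => ?_).trans
      (lintegral_mono_set (Ioi_subset_Ioi hδ.le))
    have : δ < z := hz
    gcongr
  intro htop
  rw [htop, ENNReal.mul_top hc] at h
  exact hν.2 (top_le_iff.1 h)

theorem IsLevyMeasure.integrableOn_min {ν : Measure ℝ} (hν : IsLevyMeasure ν) :
    IntegrableOn (fun z => min 1 (z ^ 2)) (Ioi 0) ν := by
  refine ⟨(by fun_prop : Measurable fun z : ℝ => min 1 (z ^ 2)).aestronglyMeasurable, ?_⟩
  rw [hasFiniteIntegral_iff_ofReal (ae_of_all _ fun z => by positivity)]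
  exact hν.2.lt_top

theorem exp_neg_sub_one_add_le {x : ℝ} (hx : 0 ≤ x) : Real.exp (-x) - 1 + x ≤ x ^ 2 := by
  rcases le_total x 1 with h | h
  · have := Real.abs_exp_sub_one_sub_id_le (x := -x) (by rwa [abs_neg, abs_of_nonneg hx])
    have := (abs_le.1 this).2
    nlinarith
  · have : Real.exp (-x) ≤ 1 := Real.exp_le_one_iff.2 (by linarith)
    nlinarith

theorem IsLevyMeasure.integrableOn_levyPsi_integrand {ν : Measure ℝ} (hν : IsLevyMeasure ν)
    {l : ℝ} (hl : 0 ≤ l) :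
    IntegrableOn (fun z => Real.exp (-l * z) - 1 +
      l * z * indicator (Ioc (0 : ℝ) 1) (fun _ => (1 : ℝ)) z) (Ioi 0) ν := by
  refine (hν.integrableOn_min.const_mul (l ^ 2 + 1)).mono' ?_ ?_
  · have : Measurable (indicator (Ioc (0 : ℝ) 1) (fun _ => (1 : ℝ))) :=
      measurable_const.indicator measurableSet_Ioc
    exact (by fun_prop : Measurable _).aestronglyMeasurable
  · refine (ae_restrict_iff' measurableSet_Ioi).2 (ae_of_all _ fun z hz => ?_)
    have hz0 : (0 : ℝ) < z := hz
    have hlz : 0 ≤ l * z := by positivity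
    have h1 : Real.exp (-l * z) ≤ 1 := Real.exp_le_one_iff.2 (by linarith)
    rw [Real.norm_eq_abs, abs_le]
    rcases le_or_gt z 1 with h | h
    · rw [indicator_of_mem (show z ∈ Ioc (0 : ℝ) 1 from ⟨hz0, h⟩), min_eq_right (by nlinarith)]
      have h2 := Real.add_one_le_exp (-(l * z))
      have h3 := exp_neg_sub_one_add_le hlz
      rw [← neg_mul] at h2 h3
      constructor <;> nlinarith [sq_nonneg z, sq_nonneg (l * z)]
    · rw [indicator_of_notMem (show z ∉ Ioc (0 : ℝ) 1 from fun hz1 => absurd hz1.2 (not_le.2 h)),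
        min_eq_left (by nlinarith)]
      have := Real.exp_pos (-l * z)
      constructor <;> nlinarith [sq_nonneg l]

theorem IsLevyMeasure.le_levyPsi {γ σ : ℝ} {ν : Measure ℝ} (hν : IsLevyMeasure ν)
    {δ : ℝ} (hδ : 0 < δ) (hδ1 : δ ≤ 1) {l : ℝ} (hl : 0 ≤ l) :
    γ * l + σ ^ 2 / 2 * l ^ 2 + (l * (∫ z in Ioc δ 1, z ∂ν) - ν.real (Ioi δ)) ≤
      levyPsi γ σ ν l := by
  unfold levyPsi
  gcongr
  have hfin := hν.measure_Ioi_ne_top hδ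
  have hi1 : IntegrableOn (fun z : ℝ => z) (Ioc δ 1) ν := by
    refine Measure.integrableOn_of_bounded (M := 1)
      (ne_top_of_le_ne_top hfin (measure_mono Ioc_subset_Ioi_self))
      measurable_id.aestronglyMeasurable ?_
    refine (ae_restrict_iff' measurableSet_Ioc).2 (ae_of_all _ fun z hz => ?_)
    rw [Real.norm_eq_abs, abs_of_pos (hδ.trans hz.1)]
    exact hz.2
  have hi1' : IntegrableOn (indicator (Ioc δ 1) fun z : ℝ => z) (Ioi 0) ν :=
    ((integrable_indicator_iff measurableSet_Ioc).2 hi1).integrableOn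
  have hi2' : IntegrableOn (indicator (Ioi δ) fun _ => (1 : ℝ)) (Ioi 0) ν :=
    ((integrable_indicator_iff measurableSet_Ioi).2 (integrableOn_const hfin)).integrableOn
  have e1 : ∫ z in Ioc δ 1, z ∂ν = ∫ z in Ioi 0, indicator (Ioc δ 1) (fun z : ℝ => z) z ∂ν := by
    rw [setIntegral_indicator measurableSet_Ioc,
      inter_eq_right.2 (Ioc_subset_Ioi_self.trans (Ioi_subset_Ioi hδ.le))]
  have e2 : ν.real (Ioi δ) = ∫ z in Ioi 0, indicator (Ioi δ) (fun _ => (1 : ℝ)) z ∂ν := by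
    rw [setIntegral_indicator measurableSet_Ioi, inter_eq_right.2 (Ioi_subset_Ioi hδ.le)]
    simp
  rw [e1, e2, ← integral_const_mul, ← integral_sub (hi1'.const_mul l) hi2']
  refine setIntegral_mono_on ((hi1'.const_mul l).sub hi2')
    (hν.integrableOn_levyPsi_integrand hl) measurableSet_Ioi fun z hz => ?_
  have hz0 : (0 : ℝ) < z := hz
  have hlz : 0 ≤ l * z := by positivity
  have h2 := Real.add_one_le_exp (-(l * z))
  have h3 := Real.exp_pos (-l * z)
  rw [← neg_mul] at h2
  simp only [indicator_apply, mem_Ioc, mem_Ioi]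
  split_ifs <;> grind

theorem tendsto_levyPsi_sub_mul_atTop {γ σ α : ℝ} (hσ : 0 ≤ σ) {ν : Measure ℝ}
    (hν : IsLevyMeasure ν) (hα : AlphaAdmissible γ σ α ν) :
    Tendsto (fun l => levyPsi γ σ ν l - α * l) atTop atTop := by
  obtain ⟨δ, hδ, hδ1, h⟩ : ∃ δ > 0, δ ≤ 1 ∧ (0 < σ ∨ α - γ < ∫ z in Ioc δ 1, z ∂ν) := by
    rcases hσ.lt_or_eq with h | h
    · exact ⟨1, one_pos, le_rfl, Or.inl h⟩
    rcases lt_or_ge (α - γ) 0 with h0 | h0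
    · exact ⟨1, one_pos, le_rfl, Or.inr (by simpa using h0)⟩
    have hS : ENNReal.ofReal (α - γ) < smallJumpMass ν := by
      by_cases htop : smallJumpMass ν = ⊤
      · exact htop ▸ ENNReal.ofReal_lt_top
      have := hα.2 ⟨h.symm, htop⟩
      exact (ENNReal.ofReal_lt_iff_lt_toReal h0 htop).2 (by linarith)
    have hU : Ioc (0 : ℝ) 1 = ⋃ n : ℕ, Ioc (1 / ((n : ℝ) + 1)) 1 := by
      ext z
      simp only [mem_Ioc, mem_iUnion]
      constructor
      · rintro ⟨h0, h1⟩
        obtain ⟨n, hn⟩ := exists_nat_one_div_lt h0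
        exact ⟨n, hn, h1⟩
      · rintro ⟨n, hn, h1⟩
        exact ⟨lt_trans (by positivity) hn, h1⟩
    rw [smallJumpMass, hU, setLIntegral_iUnion_of_directed _
      (Monotone.directed_le (f := fun n : ℕ => Ioc (1 / ((n : ℝ) + 1)) 1)
        fun m n hmn => Ioc_subset_Ioc_left (by gcongr)), lt_iSup_iff] at hS
    obtain ⟨n, hn⟩ := hS
    have hn1 : 1 / ((n : ℝ) + 1) ≤ 1 := by
      rw [div_le_one (by positivity)]; linarith [n.cast_nonneg (α := ℝ)]
    refine ⟨1 / ((n : ℝ) + 1), by positivity, hn1, Or.inr ?_⟩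
    have hpos : ∀ z ∈ Ioc (1 / ((n : ℝ) + 1)) 1, 0 ≤ z := fun z hz =>
      (lt_trans (by positivity) hz.1).le
    rw [integral_eq_lintegral_of_nonneg_ae
      ((ae_restrict_iff' measurableSet_Ioc).2 (ae_of_all _ hpos))
      measurable_id.aestronglyMeasurable]
    refine (ENNReal.ofReal_lt_iff_lt_toReal h0 ?_).1 hn
    refine ne_top_of_le_ne_top (hν.measure_Ioi_ne_top (δ := 1 / ((n : ℝ) + 1)) (by positivity))
      ?_
    calc ∫⁻ z in Ioc (1 / ((n : ℝ) + 1)) 1, ENNReal.ofReal z ∂ν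
        ≤ ∫⁻ z in Ioc (1 / ((n : ℝ) + 1)) 1, 1 ∂ν :=
          setLIntegral_mono' measurableSet_Ioc fun z hz => ENNReal.ofReal_le_one.2 hz.2
      _ ≤ _ := by
          rw [setLIntegral_one]; exact measure_mono Ioc_subset_Ioi_self
  set m := ∫ z in Ioc δ 1, z ∂ν
  have hm : Tendsto (fun l : ℝ => l * (γ + m - α + σ ^ 2 / 2 * l) - ν.real (Ioi δ))
      atTop atTop := by
    refine tendsto_atTop_add_const_right _ _ ?_
    rcases h with h | h
    · refine tendsto_id.atTop_mul_atTop₀ (tendsto_atTop_add_const_left _ _ ?_)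
      exact tendsto_id.const_mul_atTop (by positivity)
    · refine tendsto_atTop_mono' _ ?_ (tendsto_id.const_mul_atTop
        (by linarith : 0 < γ + m - α))
      filter_upwards [eventually_ge_atTop 0] with l hl
      have : 0 ≤ σ ^ 2 / 2 * l ^ 2 := by positivity
      simp only [id]; nlinarith
  refine tendsto_atTop_mono' _ ?_ hm
  filter_upwards [eventually_ge_atTop 0] with l hl
  have := hν.le_levyPsi (γ := γ) (σ := σ) hδ hδ1 hl
  nlinarith

/-- The Laplace integral of `f` over `(0,∞)` converges absolutely at `l`, with value `v`. -/
def HasLaplaceAt (f : ℝ → ℝ) (l v : ℝ) : Prop :=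
  IntegrableOn (fun y => Real.exp (-l * y) * f y) (Ioi 0) ∧
    ∫ y in Ioi (0 : ℝ), Real.exp (-l * y) * f y = v

theorem HasLaplaceAt.sub {f g : ℝ → ℝ} {l u v : ℝ} (hf : HasLaplaceAt f l u)
    (hg : HasLaplaceAt g l v) : HasLaplaceAt (fun y => f y - g y) l (u - v) := by
  simp only [HasLaplaceAt, mul_sub]
  exact ⟨hf.1.sub hg.1, by rw [integral_sub hf.1 hg.1, hf.2, hg.2]⟩

theorem HasLaplaceAt.const_mul {f : ℝ → ℝ} {l u : ℝ} (hf : HasLaplaceAt f l u) (a : ℝ) :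
    HasLaplaceAt (fun y => a * f y) l (a * u) := by
  simp only [HasLaplaceAt, mul_left_comm _ a]
  exact ⟨hf.1.const_mul a, by rw [integral_const_mul, hf.2]⟩

theorem eq_zero_of_eventually_hasLaplaceAt_zero {f : ℝ → ℝ} (hf : ContinuousOn f (Ioi 0))
    (h : ∀ᶠ l in atTop, HasLaplaceAt f l 0) {x : ℝ} (hx : 0 < x) : f x = 0 := by
  obtain ⟨l, hl⟩ := eventually_atTop.1 h
  have hae := ae_eq_zero_of_laplace_eq_zero (hl l le_rfl).1 fun n =>
    (hl (l + n) (by simp)).2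
  exact Measure.eqOn_open_of_ae_eq (μ := volume) (g := fun _ => (0 : ℝ))
    ((ae_restrict_iff' measurableSet_Ioi).2 hae) isOpen_Ioi hf continuousOn_const hx

theorem HasLaplaceAt.conv {f g : ℝ → ℝ} {l u v : ℝ} (hf : HasLaplaceAt f l u)
    (hg : HasLaplaceAt g l v) :
    HasLaplaceAt (fun x => ∫ y in (0 : ℝ)..x, f (x - y) * g y) l (u * v) := by
  set F := indicator (Ioi (0 : ℝ)) fun y => Real.exp (-l * y) * f y with hF
  set G := indicator (Ioi (0 : ℝ)) fun y => Real.exp (-l * y) * g y with hG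
  have hFi : Integrable F := (integrable_indicator_iff measurableSet_Ioi).2 hf.1
  have hGi : Integrable G := (integrable_indicator_iff measurableSet_Ioi).2 hg.1
  have hFe : ∫ y, F y = u := by rw [hF, integral_indicator measurableSet_Ioi, hf.2]
  have hGe : ∫ y, G y = v := by rw [hG, integral_indicator measurableSet_Ioi, hg.2]
  have hc : convolution G F (ContinuousLinearMap.mul ℝ ℝ) volume =
      indicator (Ioi (0 : ℝ)) fun x =>
        Real.exp (-l * x) * ∫ y in (0 : ℝ)..x, f (x - y) * g y := by
    ext x
    have hprod : ∀ t, G t * F (x - t) =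
        indicator (Ioo 0 x) (fun t => Real.exp (-l * x) * (f (x - t) * g t)) t := by
      intro t
      simp only [hF, hG, indicator_apply, mem_Ioi, mem_Ioo, sub_pos]
      split_ifs <;> try grind
      have : Real.exp (-l * x) = Real.exp (-l * t) * Real.exp (-l * (x - t)) := by
        rw [← Real.exp_add]; congr 1; ring
      rw [this]; ring
    simp only [convolution, ContinuousLinearMap.mul_apply', hprod]
    rw [integral_indicator measurableSet_Ioo]
    by_cases hx : 0 < x
    · rw [indicator_of_mem (mem_Ioi.2 hx), integral_const_mul,
        intervalIntegral.integral_of_le hx.le, integral_Ioc_eq_integral_Ioo]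
    · rw [indicator_of_notMem (by simpa using hx), Ioo_eq_empty (by simpa using hx)]
      simp
  constructor
  · rw [← integrable_indicator_iff measurableSet_Ioi, ← hc]
    exact hGi.integrable_convolution _ hFi
  · rw [← integral_indicator measurableSet_Ioi, ← hc, integral_convolution _ hGi hFi, hFe, hGe]
    simp [mul_comm]

section Extension

variable {f : ℝ → ℝ}

theorem measurable_of_continuousOn_Ici
    (hf0 : ∀ x < 0, f x = 0) (hf : ContinuousOn f (Ici 0)) : Measurable f := by
  have : f = indicator (Ici 0) fun x => f (max x 0) := by
    ext x
    by_cases hx : 0 ≤ x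
    · simp [indicator_of_mem (mem_Ici.2 hx), max_eq_left hx]
    · rw [indicator_of_notMem (by simpa using hx), hf0 x (not_le.1 hx)]
  rw [this]
  refine Measurable.indicator (Continuous.measurable ?_) measurableSet_Ici
  exact hf.comp_continuous (by fun_prop) fun x => mem_Ici.2 (le_max_right _ _)

theorem exists_abs_le_of_le
    (hf0 : ∀ x < 0, f x = 0) (hf : ContinuousOn f (Ici 0)) (T : ℝ) :
    ∃ C, 0 ≤ C ∧ ∀ x ≤ T, |f x| ≤ C := by
  obtain ⟨C, hC⟩ := isCompact_Icc.exists_bound_of_continuousOn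
    (hf.mono (Icc_subset_Ici_self : Icc 0 T ⊆ Ici 0))
  refine ⟨max C 0, le_max_right _ _, fun x hx => ?_⟩
  rcases lt_or_ge x 0 with h | h
  · simp [hf0 x h]
  · exact (hC x ⟨h, hx⟩).trans (le_max_left _ _)

theorem intervalIntegrable_comp_sub_mul
    (hf0 : ∀ x < 0, f x = 0) (hf : ContinuousOn f (Ici 0))
    {g : ℝ → ℝ} {a b : ℝ}
    (hg : IntervalIntegrable g volume a b) (x : ℝ) :
    IntervalIntegrable (fun y => f (x - y) * g y) volume a b := by
  obtain ⟨C, -, hC⟩ := exists_abs_le_of_le hf0 hf (x - min a b)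
  have hm := measurable_of_continuousOn_Ici hf0 hf
  rw [intervalIntegrable_iff] at hg ⊢
  refine Integrable.bdd_mul (c := C) hg
    (hm.comp (by fun_prop : Measurable fun y => x - y)).aestronglyMeasurable ?_
  refine (ae_restrict_iff' measurableSet_uIoc).2 (ae_of_all _ fun y hy => hC _ ?_)
  have := hy.1
  linarith

theorem integral_comp_sub_mul_eq
    (hf0 : ∀ x < 0, f x = 0) (hf : ContinuousOn f (Ici 0))
    {g : ℝ → ℝ} (hg : ∀ T > 0, IntervalIntegrable g volume 0 T)
    {x T : ℝ} (hx : 0 < x) (hxT : x ≤ T) :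
    ∫ y in (0 : ℝ)..T, f (x - y) * g y = ∫ y in (0 : ℝ)..x, f (x - y) * g y := by
  have hi := intervalIntegrable_comp_sub_mul hf0 hf (hg T (hx.trans_le hxT)) x
  have h1 : IntervalIntegrable (fun y => f (x - y) * g y) volume 0 x :=
    intervalIntegrable_comp_sub_mul hf0 hf (hg x hx) x
  rw [← intervalIntegral.integral_add_adjacent_intervals h1 (h1.symm.trans hi),
    intervalIntegral.integral_of_le hxT, setIntegral_eq_zero_of_forall_eq_zero, add_zero]
  intro y hy
  rw [hf0 _ (by linarith [hy.1]), zero_mul]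

theorem continuousOn_conv
    (hf0 : ∀ x < 0, f x = 0) (hf : ContinuousOn f (Ici 0))
    {g : ℝ → ℝ} (hg : ∀ T > 0, IntervalIntegrable g volume 0 T) :
    ContinuousOn (fun x => ∫ y in (0 : ℝ)..x, f (x - y) * g y) (Ioi 0) := by
  intro x₀ hx₀
  have hx₀' : 0 < x₀ := hx₀
  refine ContinuousAt.continuousWithinAt ?_
  have hnhds : Ioo 0 (x₀ + 1) ∈ 𝓝 x₀ := Ioo_mem_nhds hx₀ (by linarith)
  have hm := measurable_of_continuousOn_Ici hf0 hf
  obtain ⟨C, hC0, hC⟩ := exists_abs_le_of_le hf0 hf (x₀ + 1)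
  have hgT := hg (x₀ + 1) (by linarith)
  have key : ContinuousAt (fun x => ∫ y in (0 : ℝ)..(x₀ + 1), f (x - y) * g y) x₀ := by
    refine intervalIntegral.continuousAt_of_dominated_interval (bound := fun y => C * |g y|)
      ?_ ?_ (hgT.abs.const_mul C) ?_
    · refine Eventually.of_forall fun x => ?_
      exact (intervalIntegrable_iff.1
        (intervalIntegrable_comp_sub_mul hf0 hf hgT x)).aestronglyMeasurable
    · filter_upwards [hnhds] with x hx
      refine ae_of_all _ fun y hy => ?_
      rw [uIoc_of_le (by linarith)] at hy
      rw [norm_mul]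
      exact mul_le_mul_of_nonneg_right (hC _ (by linarith [hx.2, hy.1])) (abs_nonneg _)
    · have : ∀ᵐ y : ℝ, y ≠ x₀ := by simp [ae_iff]
      filter_upwards [this] with y hy _
      refine ContinuousAt.mul ?_ continuousAt_const
      refine ContinuousAt.comp (g := f) ?_ (by fun_prop)
      rcases lt_or_gt_of_ne hy with h | h
      · exact hf.continuousAt (Ici_mem_nhds (by linarith))
      · refine ContinuousAt.congr (f := fun _ => (0 : ℝ)) continuousAt_const ?_
        filter_upwards [Iio_mem_nhds (show x₀ - y < 0 by linarith)] with z hz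
        exact (hf0 z hz).symm
  refine key.congr ?_
  filter_upwards [hnhds] with x hx
  exact integral_comp_sub_mul_eq hf0 hf hg hx.1 hx.2.le

end Extension

section Derivative

variable {W W' : ℝ → ℝ}

theorem deriv_nonneg_of_monotoneOn_Ici (hm : MonotoneOn W (Ici 0))
    (hd : ∀ y : ℝ, 0 < y → HasDerivAt W (W' y) y)
    {y : ℝ} (hy : 0 < y) : 0 ≤ W' y := by
  rw [← (hd y hy).hasDerivWithinAt.derivWithin (uniqueDiffOn_Ici (0 : ℝ) y hy.le)]
  exact hm.derivWithin_nonneg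

theorem intervalIntegrable_deriv_of_monotoneOn_Ici (hc : ContinuousOn W (Ici 0))
    (hm : MonotoneOn W (Ici 0)) (hd : ∀ y : ℝ, 0 < y → HasDerivAt W (W' y) y)
    {T : ℝ} (hT : 0 < T) :
    IntervalIntegrable W' volume 0 T := by
  refine intervalIntegral.intervalIntegrable_deriv_of_nonneg (g := W)
    (hc.mono ?_) (fun x hx => hd x ?_) fun x hx => deriv_nonneg_of_monotoneOn_Ici hm hd ?_
  · rw [uIcc_of_le hT.le]; exact Icc_subset_Ici_self
  all_goals rw [min_eq_left hT.le] at hx; exact hx.1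

theorem integral_deriv_of_monotoneOn_Ici (hc : ContinuousOn W (Ici 0))
    (hm : MonotoneOn W (Ici 0)) (hd : ∀ y : ℝ, 0 < y → HasDerivAt W (W' y) y)
    {T : ℝ} (hT : 0 < T) :
    ∫ y in (0 : ℝ)..T, W' y = W T - W 0 :=
  intervalIntegral.integral_eq_sub_of_hasDerivAt_of_le hT.le
    (hc.mono Icc_subset_Ici_self) (fun x hx => hd x hx.1)
    (intervalIntegrable_deriv_of_monotoneOn_Ici hc hm hd hT)

theorem HasLaplaceAt.deriv (hc : ContinuousOn W (Ici 0))
    (hm : MonotoneOn W (Ici 0)) (hd : ∀ y : ℝ, 0 < y → HasDerivAt W (W' y) y)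
    {l v : ℝ} (hl : 0 < l) (h : HasLaplaceAt W l v) :
    HasLaplaceAt W' l (l * v - W 0) := by
  set U : ℝ → ℝ := fun s => Real.exp (-l * s) * (W (max s 0) - W 0) with hU
  have hUc : Continuous U := by
    have : Continuous fun s => W (max s 0) :=
      hc.comp_continuous (by fun_prop) fun x => mem_Ici.2 (le_max_right _ _)
    exact Continuous.mul (by fun_prop) (this.sub continuous_const)
  have hUe : ∀ s, 0 ≤ s → U s = Real.exp (-l * s) * W s - Real.exp (-l * s) * W 0 := by
    intro s hs
    rw [hU]
    simp only [max_eq_left hs, mul_sub]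
  have hE : IntegrableOn (fun s => Real.exp (-l * s) * W 0) (Ioi 0) :=
    (integrableOn_exp_mul_Ioi (by linarith) 0).mul_const _
  have hUi : IntegrableOn U (Ioi 0) :=
    (h.1.sub hE).congr_fun (fun s hs => (hUe s (le_of_lt hs)).symm) measurableSet_Ioi
  have hUint : ∫ s in Ioi (0 : ℝ), U s = v - W 0 / l := by
    rw [setIntegral_congr_fun measurableSet_Ioi fun s hs => hUe s (le_of_lt hs),
      integral_sub h.1 hE, h.2, integral_mul_const, integral_exp_mul_Ioi (by linarith)]
    simp; field_simp
  have hP : Tendsto (fun y => ∫ s in (0 : ℝ)..y, U s) atTop (𝓝 (v - W 0 / l)) :=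
    hUint ▸ intervalIntegral_tendsto_integral_Ioi 0 hUi tendsto_id
  have hdiff : Tendsto (fun y => Real.exp l *
      ((∫ s in (0 : ℝ)..(y + 1), U s) - ∫ s in (0 : ℝ)..y, U s)) atTop (𝓝 0) := by
    have := ((hP.comp (tendsto_atTop_add_const_right _ 1 tendsto_id)).sub hP).const_mul
      (Real.exp l)
    simpa using this
  have hz : Tendsto (fun y => Real.exp (-l * y) * (W y - W 0)) atTop (𝓝 0) := by
    refine tendsto_of_tendsto_of_tendsto_of_le_of_le' tendsto_const_nhds hdiff ?_ ?_
    · filter_upwards [eventually_ge_atTop 0] with y hy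
      exact mul_nonneg (Real.exp_pos _).le (sub_nonneg.2 (hm (mem_Ici.2 le_rfl) hy hy))
    · filter_upwards [eventually_ge_atTop 0] with y hy
      rw [intervalIntegral.integral_interval_sub_left (hUc.intervalIntegrable _ _)
        (hUc.intervalIntegrable _ _)]
      have hle : ∫ s in y..(y + 1), Real.exp (-l * (y + 1)) * (W y - W 0) ≤
          ∫ s in y..(y + 1), U s := by
        refine intervalIntegral.integral_mono_on (by linarith) (by simp)
          (hUc.intervalIntegrable _ _) fun s hs => ?_
        have hs0 : 0 ≤ s := hy.trans hs.1
        simp only [hU, max_eq_left hs0]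
        have h1 := hm (mem_Ici.2 le_rfl) hy hy
        have h2 := hm hy hs0 hs.1
        have h3 : Real.exp (-l * (y + 1)) ≤ Real.exp (-l * s) :=
          Real.exp_le_exp.2 (by nlinarith [hs.2])
        exact mul_le_mul h3 (by linarith) (by linarith) (Real.exp_pos _).le
      rw [intervalIntegral.integral_const, add_sub_cancel_left, one_smul] at hle
      calc Real.exp (-l * y) * (W y - W 0)
          = Real.exp l * (Real.exp (-l * (y + 1)) * (W y - W 0)) := by
            rw [← mul_assoc, ← Real.exp_add]; ring_nf
        _ ≤ _ := mul_le_mul_of_nonneg_left hle (Real.exp_pos _).le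
  set g : ℝ → ℝ := fun y => Real.exp (-l * y) * (W y - W 0) + l * ∫ s in (0 : ℝ)..y, U s with hg
  have hPd : ∀ y, HasDerivAt (fun y => ∫ s in (0 : ℝ)..y, U s) (U y) y := fun y =>
    (hUc.integral_hasStrictDerivAt 0 y).hasDerivAt
  have hgc : ContinuousWithinAt g (Ici 0) 0 := by
    refine ContinuousWithinAt.add (ContinuousWithinAt.mul (by fun_prop)
      ((hc 0 (mem_Ici.2 le_rfl)).sub continuousWithinAt_const)) ?_
    exact ((hPd 0).continuousAt.const_mul l).continuousWithinAt
  have hgd : ∀ y ∈ Ioi (0 : ℝ), HasDerivAt g (Real.exp (-l * y) * W' y) y := by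
    intro y hy
    have h1 : HasDerivAt (fun y => Real.exp (-l * y)) (Real.exp (-l * y) * (-l * 1)) y :=
      ((hasDerivAt_id y).const_mul (-l)).exp
    have h2 := (h1.mul ((hd y hy).sub_const (W 0))).add ((hPd y).const_mul l)
    refine h2.congr_deriv ?_
    simp only [hU, max_eq_left (le_of_lt (mem_Ioi.1 hy))]
    ring
  have hgpos : ∀ y ∈ Ioi (0 : ℝ), 0 ≤ Real.exp (-l * y) * W' y := fun y hy =>
    mul_nonneg (Real.exp_pos _).le (deriv_nonneg_of_monotoneOn_Ici hm hd hy)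
  have hglim : Tendsto g atTop (𝓝 (l * v - W 0)) := by
    have := hz.add (hP.const_mul l)
    convert this using 2
    field_simp; ring
  refine ⟨integrableOn_Ioi_deriv_of_nonneg hgc hgd hgpos hglim, ?_⟩
  rw [integral_Ioi_of_hasDerivAt_of_nonneg hgc hgd hgpos hglim]
  simp [hg]

end Derivative

theorem IsScaleFunction.eventually_hasLaplaceAt {f W : ℝ → ℝ} {q : ℝ}
    (hW : IsScaleFunction f (levyPhi f q) q W) (hf : Tendsto f atTop atTop) :
    ∀ᶠ l in atTop, HasLaplaceAt W l (1 / (f l - q)) := by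
  filter_upwards [eventually_gt_atTop (levyPhi f q), hf.eventually_gt_atTop q] with l hl hq
  have h := hW.2.2.2 l hl
  refine ⟨not_imp_comm.1 integral_undef ?_, h⟩
  rw [h]
  exact (one_div_pos.2 (sub_pos.2 hq)).ne'

theorem IsScaleFunction.intervalIntegrable {f W : ℝ → ℝ} {P q : ℝ}
    (hW : IsScaleFunction f P q W) {T : ℝ} (hT : 0 ≤ T) : IntervalIntegrable W volume 0 T :=
  (hW.2.1.mono (by rw [uIcc_of_le hT]; exact Icc_subset_Ici_self)).intervalIntegrable

theorem IsScaleFunction.eq_add_conv {f A B : ℝ → ℝ} {q : ℝ} (hf : Tendsto f atTop atTop)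
    (hA : IsScaleFunction f (levyPhi f q) q A) (hB : IsScaleFunction f (levyPhi f 0) 0 B)
    {x : ℝ} (hx : 0 < x) :
    A x = B x + q * ∫ y in (0 : ℝ)..x, B (x - y) * A y := by
  have hcont : ContinuousOn
      (fun x => A x - B x - q * ∫ y in (0 : ℝ)..x, B (x - y) * A y) (Ioi 0) :=
    ((hA.2.1.mono Ioi_subset_Ici_self).sub (hB.2.1.mono Ioi_subset_Ici_self)).sub
      ((continuousOn_conv hB.1 hB.2.1 fun T hT => hA.intervalIntegrable hT.le).const_mul q)
  have := eq_zero_of_eventually_hasLaplaceAt_zero hcont ?_ hx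
  · linarith
  filter_upwards [hA.eventually_hasLaplaceAt hf, hB.eventually_hasLaplaceAt hf,
    hf.eventually_gt_atTop q, hf.eventually_gt_atTop 0] with l hlA hlB hq h0
  convert (hlA.sub hlB).sub ((hlB.conv hlA).const_mul q) using 1
  have h1 : f l - q ≠ 0 := (sub_pos.2 hq).ne'
  have h2 : f l ≠ 0 := h0.ne'
  rw [sub_zero]
  field_simp
  ring

theorem IsScaleFunction.mul_eq_add_conv_deriv {f A W W' : ℝ → ℝ} {q α : ℝ} (hα : 0 < α)
    (hf : Tendsto (fun l => f l - α * l) atTop atTop)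
    (hA : IsScaleFunction (fun l => f l - α * l) (levyPhi (fun l => f l - α * l) q) q A)
    (hW : IsScaleFunction f (levyPhi f q) q W) (hd : ∀ y : ℝ, 0 < y → HasDerivAt W (W' y) y)
    {x : ℝ} (hx : 0 < x) :
    (1 - α * W 0) * A x = W x + α * ∫ y in (0 : ℝ)..x, A (x - y) * W' y := by
  have hf' : Tendsto f atTop atTop := by
    refine tendsto_atTop_mono' _ ?_ hf
    filter_upwards [eventually_ge_atTop 0] with l hl
    linarith [mul_nonneg hα.le hl]
  have hcont : ContinuousOn
      (fun x => (1 - α * W 0) * A x - W x - α * ∫ y in (0 : ℝ)..x, A (x - y) * W' y) (Ioi 0) :=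
    (((hA.2.1.mono Ioi_subset_Ici_self).const_mul _).sub (hW.2.1.mono Ioi_subset_Ici_self)).sub
      ((continuousOn_conv hA.1 hA.2.1 fun T hT =>
        intervalIntegrable_deriv_of_monotoneOn_Ici hW.2.1 hW.2.2.1 hd hT).const_mul α)
  have := eq_zero_of_eventually_hasLaplaceAt_zero hcont ?_ hx
  · linarith
  filter_upwards [hA.eventually_hasLaplaceAt hf, hW.eventually_hasLaplaceAt hf',
    hf.eventually_gt_atTop q, eventually_gt_atTop 0] with l hlA hlW hq hl
  convert ((hlA.const_mul (1 - α * W 0)).sub hlW).sub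
    ((hlA.conv (hlW.deriv hW.2.1 hW.2.2.1 hd hl)).const_mul α) using 1
  have h1 : f l - α * l - q ≠ 0 := (sub_pos.2 hq).ne'
  have h2 : f l - q ≠ 0 := by
    have := mul_pos hα hl
    linarith [sub_pos.2 hq] |> fun h : 0 < f l - q => h.ne'
  field_simp
  ring

theorem intervalIntegral_kernel_swap {k : ℝ × ℝ → ℝ} (hk : Measurable k) {a c b C : ℝ}
    (hac : a ≤ c) (hb : 0 ≤ b) (hC : ∀ y ∈ Ioc a c, ∀ z ∈ Ioc 0 b, |k (y, z)| ≤ C) {g : ℝ → ℝ}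
    (hg : IntervalIntegrable g volume 0 b) :
    IntervalIntegrable (fun z => (∫ y in a..c, k (y, z)) * g z) volume 0 b ∧
      IntervalIntegrable (fun y => ∫ z in (0 : ℝ)..b, k (y, z) * g z) volume a c ∧
      ∫ y in a..c, ∫ z in (0 : ℝ)..b, k (y, z) * g z =
        ∫ z in (0 : ℝ)..b, (∫ y in a..c, k (y, z)) * g z := by
  simp only [intervalIntegral.integral_of_le hac, intervalIntegral.integral_of_le hb]
  rw [intervalIntegrable_iff_integrableOn_Ioc_of_le hac]
  rw [intervalIntegrable_iff_integrableOn_Ioc_of_le hb] at hg ⊢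
  have hi : Integrable (Function.uncurry fun y z => k (y, z) * g z)
      ((volume.restrict (Ioc a c)).prod (volume.restrict (Ioc 0 b))) := by
    refine Integrable.bdd_mul (c := C) (f := k) (g := fun p => g p.2)
      (hg.comp_snd (volume.restrict (Ioc a c))) hk.aestronglyMeasurable ?_
    rw [Measure.prod_restrict]
    exact (ae_restrict_iff' (measurableSet_Ioc.prod measurableSet_Ioc)).2
      (ae_of_all _ fun p hp => hC p.1 hp.1 p.2 hp.2)
  refine ⟨?_, hi.integral_prod_left, ?_⟩
  · have := hi.integral_prod_right
    simpa only [IntegrableOn, Function.uncurry_apply_pair, integral_mul_const] using this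
  · rw [integral_integral_swap hi]
    simp only [integral_mul_const]

theorem IsScaleFunction.exists_abs_le {f B : ℝ → ℝ} {P q L : ℝ}
    (hB : IsScaleFunction f P q B) (hlim : Tendsto B atTop (𝓝 L)) :
    ∃ M, 0 ≤ M ∧ ∀ x, |B x| ≤ M := by
  obtain ⟨T, hT⟩ := eventually_atTop.1 (hlim.abs.eventually_le_const (lt_add_one |L|))
  obtain ⟨C, hC0, hC⟩ := exists_abs_le_of_le hB.1 hB.2.1 T
  refine ⟨max C (|L| + 1), le_max_of_le_left hC0, fun x => ?_⟩
  rcases le_total x T with h | h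
  · exact (hC x h).trans (le_max_left _ _)
  · exact (hT x h).trans (le_max_right _ _)

section Limit

variable {f A B : ℝ → ℝ} {q L : ℝ}

theorem IsScaleFunction.sub_integral_shift (hA : IsScaleFunction f (levyPhi f q) q A)
    (hB : IsScaleFunction f (levyPhi f 0) 0 B)
    (hf : Tendsto f atTop atTop)
    {b c z : ℝ} (hzb : z ≤ b) (hbc : b < c) :
    A (c - z) - q * ∫ y in b..c, B (c - y) * A (y - z) =
      B (c - z) + q * ∫ u in (0 : ℝ)..(b - z), B (c - z - u) * A u := by
  rw [hA.eq_add_conv hf hB (by linarith : 0 < c - z)]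
  have h1 : ∫ y in b..c, B (c - y) * A (y - z) =
      ∫ u in (b - z)..(c - z), B (c - z - u) * A u := by
    rw [← intervalIntegral.integral_comp_sub_right (fun u => B (c - z - u) * A u) z]
    simp only [sub_sub_sub_cancel_right]
  have h2 : IntervalIntegrable (fun u => B (c - z - u) * A u) volume 0 (b - z) :=
    intervalIntegrable_comp_sub_mul hB.1 hB.2.1 (hA.intervalIntegrable (by linarith)) _
  have h3 : IntervalIntegrable (fun u => B (c - z - u) * A u) volume 0 (c - z) :=
    intervalIntegrable_comp_sub_mul hB.1 hB.2.1 (hA.intervalIntegrable (by linarith)) _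
  rw [h1, ← intervalIntegral.integral_add_adjacent_intervals h2 (h2.symm.trans h3)]
  ring

theorem IsScaleFunction.kernel_swap (hA : IsScaleFunction f (levyPhi f q) q A)
    (hB : IsScaleFunction f (levyPhi f 0) 0 B)
    {b c : ℝ} (hb : 0 ≤ b) (hbc : b < c) {g : ℝ → ℝ}
    (hg : IntervalIntegrable g volume 0 b) :
    IntervalIntegrable (fun z => (∫ y in b..c, B (c - y) * A (y - z)) * g z) volume 0 b ∧
      IntervalIntegrable (fun y => B (c - y) * ∫ z in (0 : ℝ)..b, A (y - z) * g z) volume b c ∧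
      ∫ y in b..c, B (c - y) * ∫ z in (0 : ℝ)..b, A (y - z) * g z =
        ∫ z in (0 : ℝ)..b, (∫ y in b..c, B (c - y) * A (y - z)) * g z := by
  obtain ⟨CA, hCA0, hCA⟩ := exists_abs_le_of_le hA.1 hA.2.1 c
  obtain ⟨CB, hCB0, hCB⟩ := exists_abs_le_of_le hB.1 hB.2.1 c
  have hAm := measurable_of_continuousOn_Ici hA.1 hA.2.1
  have hBm := measurable_of_continuousOn_Ici hB.1 hB.2.1
  have hk : Measurable fun p : ℝ × ℝ => B (c - p.1) * A (p.1 - p.2) := by fun_prop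
  have := intervalIntegral_kernel_swap hk hbc.le hb (C := CB * CA) (fun y hy z hz => by
    rw [abs_mul]
    exact mul_le_mul (hCB _ (by linarith [hy.1])) (hCA _ (by linarith [hy.2, hz.1]))
      (abs_nonneg _) hCB0) hg
  simpa only [mul_assoc, intervalIntegral.integral_const_mul] using this

theorem IsScaleFunction.tendsto_integral_shift (hA : IsScaleFunction f (levyPhi f q) q A)
    (hB : IsScaleFunction f (levyPhi f 0) 0 B) (hlim : Tendsto B atTop (𝓝 L))
    {d : ℝ} (hd : 0 ≤ d) (z : ℝ) :
    Tendsto (fun c => B (c - z) + q * ∫ u in (0 : ℝ)..d, B (c - z - u) * A u) atTop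
      (𝓝 (L * (1 + q * ∫ u in (0 : ℝ)..d, A u))) := by
  obtain ⟨M, hM0, hM⟩ := hB.exists_abs_le hlim
  have hs : ∀ w, Tendsto (fun c => B (c - w)) atTop (𝓝 L) := fun w =>
    hlim.comp (tendsto_atTop_add_const_right _ (-w) tendsto_id)
  have hAi := hA.intervalIntegrable hd
  have hint : Tendsto (fun c => ∫ u in (0 : ℝ)..d, B (c - z - u) * A u) atTop
      (𝓝 (∫ u in (0 : ℝ)..d, L * A u)) := by
    refine intervalIntegral.tendsto_integral_filter_of_dominated_convergence
      (fun u => M * |A u|) ?_ ?_ (hAi.abs.const_mul M) ?_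
    · exact Eventually.of_forall fun c => (intervalIntegrable_iff.1
        (intervalIntegrable_comp_sub_mul hB.1 hB.2.1 hAi _)).aestronglyMeasurable
    · refine Eventually.of_forall fun c => ae_of_all _ fun u _ => ?_
      rw [norm_mul]
      exact mul_le_mul_of_nonneg_right (hM _) (abs_nonneg _)
    · refine ae_of_all _ fun u _ => ?_
      simpa only [sub_sub] using (hs (z + u)).mul_const (A u)
  rw [intervalIntegral.integral_const_mul] at hint
  convert (hs z).add (hint.const_mul q) using 2
  ring

theorem IsScaleFunction.tendsto_integral_kernel (hA : IsScaleFunction f (levyPhi f q) q A)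
    (hB : IsScaleFunction f (levyPhi f 0) 0 B) (hlim : Tendsto B atTop (𝓝 L))
    (hf : Tendsto f atTop atTop)
    {b : ℝ} (hb : 0 ≤ b) {g : ℝ → ℝ}
    (hg : IntervalIntegrable g volume 0 b) :
    Tendsto (fun c => ∫ z in (0 : ℝ)..b,
        (A (c - z) - q * ∫ y in b..c, B (c - y) * A (y - z)) * g z) atTop
      (𝓝 (∫ z in (0 : ℝ)..b, L * (1 + q * ∫ u in (0 : ℝ)..(b - z), A u) * g z)) := by
  obtain ⟨M, hM0, hM⟩ := hB.exists_abs_le hlim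
  obtain ⟨CA, hCA0, hCA⟩ := exists_abs_le_of_le hA.1 hA.2.1 b
  refine intervalIntegral.tendsto_integral_filter_of_dominated_convergence
    (fun z => (M + |q| * (M * CA * b)) * |g z|) ?_ ?_ (hg.abs.const_mul _) ?_
  · filter_upwards [eventually_gt_atTop b] with c hc
    refine (intervalIntegrable_iff.1 ?_).aestronglyMeasurable
    simp only [sub_mul, mul_assoc]
    exact (intervalIntegrable_comp_sub_mul hA.1 hA.2.1 hg c).sub
      ((hA.kernel_swap hB hb hc hg).1.const_mul q)
  · filter_upwards [eventually_gt_atTop b] with c hc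
    refine ae_of_all _ fun z hz => ?_
    rw [uIoc_of_le hb] at hz
    rw [hA.sub_integral_shift hB hf hz.2 hc, norm_mul]
    refine mul_le_mul_of_nonneg_right ((norm_add_le _ _).trans ?_) (abs_nonneg _)
    refine add_le_add (hM _) ?_
    rw [norm_mul]
    refine mul_le_mul_of_nonneg_left ?_ (abs_nonneg _)
    have h1 := intervalIntegral.norm_integral_le_of_norm_le_const (C := M * CA)
      (a := 0) (b := b - z) (f := fun u => B (c - z - u) * A u) fun u hu => by
        rw [uIoc_of_le (by linarith [hz.2])] at hu
        rw [norm_mul]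
        exact mul_le_mul (hM _) (hCA _ (by linarith [hu.2, hz.1])) (abs_nonneg _) hM0
    refine h1.trans (mul_le_mul_of_nonneg_left ?_ (by positivity))
    rw [abs_of_nonneg (by linarith [hz.2])]
    linarith [hz.1]
  · refine ae_of_all _ fun z hz => ?_
    rw [uIoc_of_le hb] at hz
    refine Tendsto.mul_const _ ?_
    refine (hA.tendsto_integral_shift hB hlim (d := b - z) (by linarith [hz.2]) z).congr' ?_
    filter_upwards [eventually_gt_atTop b] with c hc
    exact (hA.sub_integral_shift hB hf hz.2 hc).symm

end Limit

section Refracted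

variable {f A W W' : ℝ → ℝ} {P q α : ℝ}

theorem refractedW_eq (hA : IsScaleFunction f P q A)
    (hAW : ∀ x > 0, (1 - α * W 0) * A x = W x + α * ∫ y in (0 : ℝ)..x, A (x - y) * W' y)
    (hW' : ∀ T > 0, IntervalIntegrable W' volume 0 T) {b x : ℝ} (hb : 0 < b)
    (hbx : b ≤ x) :
    refractedW α b W W' A x =
      (1 - α * W 0) * A x - α * ∫ z in (0 : ℝ)..b, A (x - z) * W' z := by
  have hx := hb.trans_le hbx
  have h1 := intervalIntegrable_comp_sub_mul hA.1 hA.2.1 (hW' b hb) x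
  have h2 := intervalIntegrable_comp_sub_mul hA.1 hA.2.1 (hW' x hx) x
  rw [refractedW, if_pos hbx, hAW x hx,
    ← intervalIntegral.integral_add_adjacent_intervals h1 (h1.symm.trans h2)]
  ring

theorem integral_resolvent_eq (hA : IsScaleFunction f P q A)
    (hAW : ∀ x > 0, (1 - α * W 0) * A x = W x + α * ∫ y in (0 : ℝ)..x, A (x - y) * W' y)
    {Φq : ℝ} {g : ℝ → ℝ} (hW : IsScaleFunction g Φq q W)
    (hd : ∀ y : ℝ, 0 < y → HasDerivAt W (W' y) y) {b : ℝ} (hb : 0 < b) :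
    (1 - α * W 0) * (1 + q * ∫ y in (0:ℝ)..b, A y) -
        α * ∫ z in (0:ℝ)..b, W' z * (1 + q * ∫ y in (0:ℝ)..(b - z), A y) =
      (1 + q * ∫ y in (0:ℝ)..b, W y) - α * W b := by
  have hW' : ∀ T > 0, IntervalIntegrable W' volume 0 T := fun T hT =>
    intervalIntegrable_deriv_of_monotoneOn_Ici hW.2.1 hW.2.2.1 hd hT
  obtain ⟨C, hC0, hC⟩ := exists_abs_le_of_le hA.1 hA.2.1 b
  have hAm := measurable_of_continuousOn_Ici hA.1 hA.2.1
  have hAi : ∀ a c : ℝ, a ≤ 0 → 0 ≤ c → IntervalIntegrable A volume a c := by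
    intro a c ha hc
    refine IntervalIntegrable.trans (b := 0) ?_ (hA.intervalIntegrable hc)
    refine (intervalIntegrable_const (c := (0 : ℝ))).congr_uIoo fun y hy => ?_
    rw [uIoo_of_le ha] at hy
    exact (hA.1 y hy.2).symm
  obtain ⟨hi1, hi2, hsw⟩ := intervalIntegral_kernel_swap (k := fun p : ℝ × ℝ => A (p.1 - p.2))
    (by fun_prop) hb.le hb.le (C := C)
    (fun y hy z hz => hC _ (by linarith [hy.2, hz.1])) (hW' b hb)
  have hshift : ∀ z ∈ uIcc 0 b,
      (∫ x in (0 : ℝ)..b, A (x - z)) * W' z = W' z * ∫ y in (0 : ℝ)..(b - z), A y := by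
    intro z hz
    rw [uIcc_of_le hb.le] at hz
    rw [mul_comm, intervalIntegral.integral_comp_sub_right A z,
      ← intervalIntegral.integral_add_adjacent_intervals (a := 0 - z) (b := 0)
        (hAi _ _ (by linarith [hz.1]) le_rfl) (hAi _ _ le_rfl (by linarith [hz.2]))]
    congr 1
    rw [add_eq_right, intervalIntegral.integral_of_le (by linarith [hz.1]),
      integral_Ioc_eq_integral_Ioo]
    exact setIntegral_eq_zero_of_forall_eq_zero fun y hy => hA.1 y hy.2
  have hint : (1 - α * W 0) * ∫ y in (0 : ℝ)..b, A y = (∫ y in (0 : ℝ)..b, W y) +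
      α * ∫ z in (0 : ℝ)..b, W' z * ∫ y in (0 : ℝ)..(b - z), A y := by
    rw [← intervalIntegral.integral_congr hshift, ← hsw,
      ← intervalIntegral.integral_const_mul, ← intervalIntegral.integral_const_mul,
      ← intervalIntegral.integral_add (hW.intervalIntegrable hb.le) (hi2.const_mul α)]
    refine intervalIntegral.integral_congr_ae (ae_of_all _ fun x hx => ?_)
    rw [uIoc_of_le hb.le] at hx
    rw [hAW x hx.1, ← integral_comp_sub_mul_eq hA.1 hA.2.1 hW' hx.1 hx.2]
  have hi3 : IntervalIntegrable (fun z => W' z * (q * ∫ y in (0 : ℝ)..(b - z), A y))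
      volume 0 b := by
    refine (hi1.const_mul q).congr_uIoo fun z hz => ?_
    simp only
    rw [hshift z (uIoo_subset_uIcc_self hz)]
    ring
  have hsplit : ∫ z in (0 : ℝ)..b, W' z * (1 + q * ∫ y in (0 : ℝ)..(b - z), A y) =
      (W b - W 0) + q * ∫ z in (0 : ℝ)..b, W' z * ∫ y in (0 : ℝ)..(b - z), A y := by
    simp only [mul_add, mul_one]
    rw [intervalIntegral.integral_add (hW' b hb) hi3,
      integral_deriv_of_monotoneOn_Ici hW.2.1 hW.2.2.1 hd hb]
    simp only [mul_left_comm _ q, intervalIntegral.integral_const_mul]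
  rw [hsplit]
  linear_combination q * hint

theorem refractedW_sub_integral_eq (hA : IsScaleFunction f (levyPhi f q) q A)
    (hAW : ∀ x > 0, (1 - α * W 0) * A x = W x + α * ∫ y in (0 : ℝ)..x, A (x - y) * W' y)
    (hW' : ∀ T > 0, IntervalIntegrable W' volume 0 T)
    {B : ℝ → ℝ} (hB : IsScaleFunction f (levyPhi f 0) 0 B) {b c : ℝ}
    (hb : 0 < b) (hbc : b < c) :
    refractedW α b W W' A c - q * ∫ y in b..c, B (c - y) * refractedW α b W W' A y =
      (1 - α * W 0) * (A c - q * ∫ y in b..c, B (c - y) * A y) -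
        α * ∫ z in (0 : ℝ)..b,
          (A (c - z) - q * ∫ y in b..c, B (c - y) * A (y - z)) * W' z := by
  obtain ⟨hi1, hi2, hsw⟩ := hA.kernel_swap hB hb.le hbc (hW' b hb)
  have hBA : IntervalIntegrable (fun y => B (c - y) * A y) volume b c :=
    (intervalIntegrable_comp_sub_mul hB.1 hB.2.1 (hA.intervalIntegrable hb.le) c).symm.trans
      (intervalIntegrable_comp_sub_mul hB.1 hB.2.1
        (hA.intervalIntegrable (hb.trans hbc).le) c)
  have h1 : ∫ y in b..c, B (c - y) * refractedW α b W W' A y =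
      (1 - α * W 0) * (∫ y in b..c, B (c - y) * A y) -
        α * ∫ z in (0 : ℝ)..b, (∫ y in b..c, B (c - y) * A (y - z)) * W' z := by
    rw [← hsw, ← intervalIntegral.integral_const_mul, ← intervalIntegral.integral_const_mul,
      ← intervalIntegral.integral_sub (hBA.const_mul _) (hi2.const_mul _)]
    refine intervalIntegral.integral_congr fun y hy => ?_
    rw [uIcc_of_le hbc.le] at hy
    rw [refractedW_eq hA hAW hW' hb hy.1]
    ring
  have h2 : ∫ z in (0 : ℝ)..b,
        (A (c - z) - q * ∫ y in b..c, B (c - y) * A (y - z)) * W' z =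
      (∫ z in (0 : ℝ)..b, A (c - z) * W' z) -
        q * ∫ z in (0 : ℝ)..b, (∫ y in b..c, B (c - y) * A (y - z)) * W' z := by
    simp only [sub_mul, mul_assoc]
    rw [intervalIntegral.integral_sub
      (intervalIntegrable_comp_sub_mul hA.1 hA.2.1 (hW' b hb) c) (hi1.const_mul q),
      intervalIntegral.integral_const_mul]
  rw [h1, h2, refractedW_eq hA hAW hW' hb hbc.le]
  ring

end Refracted

/-- If `𝕎` has a finite positive limit `L` at infinity, then
`lim_{c→∞} [ w^{(q)}(c;0) - q∫_b^c 𝕎(c-y) w^{(q)}(y;0) dy ] / 𝕎(c)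
  = (1 - α W^{(q)}(0)) ℤ^{(q)}(b) - α∫₀^b W^{(q)′}(z) ℤ^{(q)}(b-z) dz`,
and this quantity equals `Z^{(q)}(b) - α W^{(q)}(b)`. -/
theorem refracted_w_limit_ratio
    (γ σ : ℝ) (hσ : 0 ≤ σ) (ν : Measure ℝ) (hν : IsLevyMeasure ν)
    (hnd : NonDegenerate γ σ ν)
    (α : ℝ) (hα : AlphaAdmissible γ σ α ν)
    (b : ℝ) (hb : 0 < b) (q : ℝ) (hq : 0 ≤ q)
    (W W' Wαq Wα0 : ℝ → ℝ)
    (hW : IsScaleFunction (levyPsi γ σ ν) (levyPhi (levyPsi γ σ ν) q) q W)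
    (hW' : (∀ y : ℝ, 0 < y → HasDerivAt W (W' y) y) ∧ ContinuousOn W' (Set.Ioi 0))
    (hWαq : IsScaleFunction (fun l => levyPsi γ σ ν l - α * l)
      (levyPhi (fun l => levyPsi γ σ ν l - α * l) q) q Wαq)
    (hWα0 : IsScaleFunction (fun l => levyPsi γ σ ν l - α * l)
      (levyPhi (fun l => levyPsi γ σ ν l - α * l) 0) 0 Wα0)
    (L : ℝ) (hL : 0 < L) (hlim : Tendsto Wα0 atTop (nhds L)) :
    Tendsto
      (fun c : ℝ =>
        (refractedW α b W W' Wαq c -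
            q * ∫ y in b..c, Wα0 (c - y) * refractedW α b W W' Wαq y) / Wα0 c)
      atTop
      (nhds ((1 - α * W 0) * (1 + q * ∫ y in (0:ℝ)..b, Wαq y) -
        α * ∫ z in (0:ℝ)..b, W' z * (1 + q * ∫ y in (0:ℝ)..(b - z), Wαq y))) ∧
    (1 - α * W 0) * (1 + q * ∫ y in (0:ℝ)..b, Wαq y) -
        α * ∫ z in (0:ℝ)..b, W' z * (1 + q * ∫ y in (0:ℝ)..(b - z), Wαq y) =
      (1 + q * ∫ y in (0:ℝ)..b, W y) - α * W b := by
  have hf := tendsto_levyPsi_sub_mul_atTop hσ hν hα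
  have hWi : ∀ T > 0, IntervalIntegrable W' volume 0 T := fun T hT =>
    intervalIntegrable_deriv_of_monotoneOn_Ici hW.2.1 hW.2.2.1 hW'.1 hT
  have hAW : ∀ x > 0, (1 - α * W 0) * Wαq x =
      W x + α * ∫ y in (0 : ℝ)..x, Wαq (x - y) * W' y := fun x hx =>
    IsScaleFunction.mul_eq_add_conv_deriv hα.1 hf hWαq hW hW'.1 hx
  refine ⟨?_, integral_resolvent_eq hWαq hAW hW hW'.1 hb⟩
  have h1 := (hWαq.tendsto_integral_shift hWα0 hlim hb.le 0).const_mul (1 - α * W 0)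
  have h2 := (hWαq.tendsto_integral_kernel hWα0 hlim hf hb.le (hWi b hb)).const_mul α
  have h3 : ∫ z in (0 : ℝ)..b, L * (1 + q * ∫ y in (0 : ℝ)..(b - z), Wαq y) * W' z =
      L * ∫ z in (0 : ℝ)..b, W' z * (1 + q * ∫ y in (0 : ℝ)..(b - z), Wαq y) := by
    rw [← intervalIntegral.integral_const_mul]
    congr 1 with z
    ring
  have h4 := (h1.sub h2).div hlim hL.ne'
  rw [h3, mul_left_comm _ L, mul_left_comm _ L, ← mul_sub, mul_div_cancel_left₀ _ hL.ne'] at h4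
  refine h4.congr' ?_
  filter_upwards [eventually_gt_atTop b] with c hc
  have h5 := hWαq.sub_integral_shift hWα0 hf hb.le hc
  simp only [sub_zero] at h5 ⊢
  rw [refractedW_sub_integral_eq hWαq hAW hWi hWα0 hb hc, h5]
  rfl
end

section
/- Assume q > 0 and ψ′(0+) > α, so that Φ(q) > 0 and q − αΦ(q) > 0, and assume moreover that 𝕎 is bounded and continuously differentiable on (0,∞) with derivative 𝕎′. Then for every u ≥ 0, (Φ(q)/(q − αΦ(q))) e^{Φ(q)u} ( 1 − (q − αΦ(q)) ∫₀^u e^{−Φ(q)y} 𝕎(y) dy ) = 𝕎(u) + ∫₀^∞ e^{−Φ(q)y} 𝕎′(y+u) dy. -/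
open MeasureTheory Set Filter Topology

/-- The integrand of the Lévy-Khintchine formula of a spectrally negative Lévy process. -/
noncomputable def levyIntegrand (l z : ℝ) : ℝ :=
  Real.exp (-l * z) - 1 + l * z * Set.indicator (Set.Ioc (0 : ℝ) 1) (fun _ => (1 : ℝ)) z

theorem abs_levyIntegrand_le {l z : ℝ} (hl : 0 ≤ l) (hz : 0 < z) :
    |levyIntegrand l z| ≤ (1 + l ^ 2) * min 1 (z ^ 2) := by
  have hx : 0 ≤ l * z := mul_nonneg hl hz.le
  unfold levyIntegrand
  rw [neg_mul]
  rcases le_or_gt z 1 with h1 | h1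
  · rw [indicator_of_mem (mem_Ioc.2 ⟨hz, h1⟩), mul_one,
      min_eq_right (by nlinarith)]
    have hlow := Real.add_one_le_exp (-(l * z))
    have hup : Real.exp (-(l * z)) * (l * z + 1) ≤ 1 := by
      calc Real.exp (-(l * z)) * (l * z + 1)
          ≤ Real.exp (-(l * z)) * Real.exp (l * z) := by
            gcongr
            exact Real.add_one_le_exp _
        _ = 1 := by rw [← Real.exp_add]; simp
    rw [abs_of_nonneg (by linarith)]
    nlinarith [sq_nonneg z]
  · rw [indicator_of_notMem (fun h => h1.not_ge h.2), mul_zero, add_zero,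
      min_eq_left (by nlinarith), abs_le]
    have h2 : Real.exp (-(l * z)) ≤ 1 := Real.exp_le_one_iff.2 (by linarith)
    constructor <;> nlinarith [Real.exp_pos (-(l * z)), sq_nonneg l]

theorem IsLevyMeasure.integrableOn_levyIntegrand {ν : Measure ℝ} (hν : IsLevyMeasure ν) {l : ℝ}
    (hl : 0 ≤ l) : IntegrableOn (levyIntegrand l) (Ioi 0) ν := by
  have hmin : IntegrableOn (fun z : ℝ => min 1 (z ^ 2)) (Ioi 0) ν := by
    refine ⟨by fun_prop, ?_⟩
    rw [hasFiniteIntegral_iff_ofReal (Eventually.of_forall fun z => by positivity)]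
    exact lt_top_iff_ne_top.2 hν.2
  have hmeas : Measurable (levyIntegrand l) := by
    unfold levyIntegrand
    exact (by fun_prop : Measurable fun z : ℝ => Real.exp (-l * z) - 1).add
      ((by fun_prop : Measurable fun z : ℝ => l * z).mul
        (measurable_const.indicator measurableSet_Ioc))
  refine (hmin.const_mul (1 + l ^ 2)).mono' hmeas.aestronglyMeasurable ?_
  filter_upwards [ae_restrict_mem measurableSet_Ioi] with z hz
  exact abs_levyIntegrand_le hl hz

theorem levyIntegrand_convex (x y z : ℝ) {a b : ℝ} (ha : 0 ≤ a) (hb : 0 ≤ b)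
    (hab : a + b = 1) :
    levyIntegrand (a * x + b * y) z ≤ a * levyIntegrand x z + b * levyIntegrand y z := by
  unfold levyIntegrand
  have h := convexOn_exp.2 (mem_univ (-x * z)) (mem_univ (-y * z)) ha hb hab
  simp only [smul_eq_mul] at h
  rw [show a * (-x * z) + b * (-y * z) = -(a * x + b * y) * z by ring] at h
  linear_combination h + hab

theorem IsLevyMeasure.convexOn_levyPsi {ν : Measure ℝ} (hν : IsLevyMeasure ν) (γ σ : ℝ) :
    ConvexOn ℝ (Ici 0) (levyPsi γ σ ν) := by
  refine ⟨convex_Ici 0, fun x hx y hy a b ha hb hab => ?_⟩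
  have hxy : 0 ≤ a * x + b * y := add_nonneg (mul_nonneg ha hx) (mul_nonneg hb hy)
  have hix := (hν.integrableOn_levyIntegrand hx).const_mul a
  have hiy := (hν.integrableOn_levyIntegrand hy).const_mul b
  have h_int := integral_mono (hν.integrableOn_levyIntegrand hxy) (hix.add hiy)
    (fun z => levyIntegrand_convex x y z ha hb hab)
  rw [integral_add' hix hiy, integral_const_mul, integral_const_mul] at h_int
  have hsq : (a * x + b * y) ^ 2 ≤ a * x ^ 2 + b * y ^ 2 := by
    have := (even_two.convexOn_pow (𝕜 := ℝ)).2 (mem_univ x) (mem_univ y) ha hb hab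
    simpa only [smul_eq_mul] using this
  have hsq' := mul_le_mul_of_nonneg_left hsq (by positivity : 0 ≤ σ ^ 2 / 2)
  simp only [smul_eq_mul]
  change γ * (a * x + b * y) + σ ^ 2 / 2 * (a * x + b * y) ^ 2 +
      ∫ z in Ioi (0 : ℝ), levyIntegrand (a * x + b * y) z ∂ν ≤
    a * (γ * x + σ ^ 2 / 2 * x ^ 2 + ∫ z in Ioi (0 : ℝ), levyIntegrand x z ∂ν) +
      b * (γ * y + σ ^ 2 / 2 * y ^ 2 + ∫ z in Ioi (0 : ℝ), levyIntegrand y z ∂ν)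
  linarith

theorem levyPsi_zero (γ σ : ℝ) (ν : Measure ℝ) : levyPsi γ σ ν 0 = 0 := by
  simp [levyPsi]

/-- For a convex function `f` on `[0,∞)` with `f 0 = 0` and positive right derivative `d` at `0`,
the value `levyPhi f q` is a positive solution of `f l = q`, bounded by `q / d`. -/
theorem levyPhi_spec {f : ℝ → ℝ} {d q : ℝ} (hf : ConvexOn ℝ (Ici 0) f) (hf0 : f 0 = 0)
    (hder : HasDerivWithinAt f d (Ici 0) 0) (hd : 0 < d) (hq : 0 < q) :
    0 < levyPhi f q ∧ f (levyPhi f q) = q ∧ d * levyPhi f q ≤ q := by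
  have hlow : ∀ l, 0 ≤ l → d * l ≤ f l := by
    intro l hl
    rcases hl.eq_or_lt with rfl | hl
    · simp [hf0]
    · have h := hf.le_slope_of_hasDerivWithinAt self_mem_Ici hl.le hl hder
      rwa [slope_def_field, hf0, sub_zero, sub_zero, le_div_iff₀ hl] at h
  have hcont : ContinuousOn f (Ici 0) := by
    intro x hx
    rcases (mem_Ici.1 hx).eq_or_lt with rfl | hx
    · exact hder.continuousWithinAt
    · have h := hf.continuousOn_interior
      rw [interior_Ici] at h
      exact (h.continuousAt (Ioi_mem_nhds hx)).continuousWithinAt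
  have hqd : 0 ≤ q / d := by positivity
  obtain ⟨l, hl, hlq⟩ : q ∈ f '' Icc 0 (q / d) := by
    refine intermediate_value_Icc hqd (hcont.mono Icc_subset_Ici_self) ⟨by linarith, ?_⟩
    have h := hlow _ hqd
    rwa [mul_div_cancel₀ _ hd.ne'] at h
  have hstrict : ∀ x y, 0 ≤ x → x < y → f y = q → f x < q := by
    intro x y hx hxy hy
    have hy0 : 0 < y := hx.trans_lt hxy
    have h := hf.2 (self_mem_Ici (a := (0 : ℝ))) hy0.le
      (sub_nonneg.2 ((div_le_one hy0).2 hxy.le)) (div_nonneg hx hy0.le) (by ring)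
    simp only [smul_eq_mul, mul_zero, zero_add, hf0, hy, div_mul_cancel₀ _ hy0.ne'] at h
    have : x / y < 1 := (div_lt_one hy0).2 hxy
    nlinarith
  have hset : {x : ℝ | 0 ≤ x ∧ f x = q} = {l} := by
    refine eq_singleton_iff_unique_mem.2 ⟨⟨hl.1, hlq⟩, fun x hx => ?_⟩
    rcases lt_trichotomy x l with h | h | h
    · exact absurd hx.2 (hstrict x l hx.1 h hlq).ne
    · exact h
    · exact absurd hlq (hstrict l x hl.1 h hx.2).ne
  have hphi : levyPhi f q = l := by rw [levyPhi, hset, csSup_singleton]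
  rw [hphi]
  refine ⟨hl.1.lt_of_ne ?_, hlq, hlq ▸ hlow l hl.1⟩
  rintro rfl
  linarith

theorem setIntegral_Ioi_comp_add_right (f : ℝ → ℝ) (u : ℝ) :
    ∫ y in Ioi 0, f (y + u) = ∫ y in Ioi u, f y := by
  have h := (measurePreserving_add_right volume u).setIntegral_preimage_emb
    (measurableEmbedding_addRight u) f (Ioi u)
  simpa using h

theorem MonotoneOn.exists_tendsto_atTop_of_abs_le {f : ℝ → ℝ} {a M : ℝ}
    (hf : MonotoneOn f (Ici a)) (hM : ∀ x, |f x| ≤ M) : ∃ l, Tendsto f atTop (𝓝 l) := by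
  have hmono : Monotone fun x => f (max a x) := fun x y hxy =>
    hf (le_max_left a x) (le_max_left a y) (max_le_max_left a hxy)
  refine ⟨_, (tendsto_atTop_ciSup hmono ⟨M, ?_⟩).congr' ?_⟩
  · rintro _ ⟨x, rfl⟩
    exact (abs_le.1 (hM _)).2
  · filter_upwards [eventually_ge_atTop a] with x hx
    rw [max_eq_right hx]

theorem MonotoneOn.deriv_nonneg_of_hasDerivAt {f : ℝ → ℝ} {a x f' : ℝ}
    (hf : MonotoneOn f (Ici a)) (hx : a < x) (h : HasDerivAt f f' x) : 0 ≤ f' := by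
  have hn := hf.derivWithin_nonneg (x := x)
  rwa [derivWithin_of_mem_nhds (Ici_mem_nhds hx), h.deriv] at hn

section LaplaceTransform

variable {W W' : ℝ → ℝ} {p u M : ℝ}

theorem integrableOn_exp_neg_mul_of_abs_le (hp : 0 < p) (hu : 0 ≤ u)
    (hcont : ContinuousOn W (Ici 0)) (hM : ∀ x, |W x| ≤ M) :
    IntegrableOn (fun y => Real.exp (-p * y) * W y) (Ioi u) := by
  refine (integrableOn_exp_mul_Ioi (neg_lt_zero.2 hp) u).mul_bdd (c := M)
    ((hcont.mono (Ioi_subset_Ici hu)).aestronglyMeasurable measurableSet_Ioi) ?_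
  exact Eventually.of_forall hM

theorem setIntegral_Ioi_exp_neg_mul_deriv (hp : 0 < p) (hu : 0 ≤ u)
    (hcont : ContinuousOn W (Ici 0)) (hmono : MonotoneOn W (Ici 0)) (hM : ∀ x, |W x| ≤ M)
    (hW' : ∀ y, 0 < y → HasDerivAt W (W' y) y) :
    ∫ y in Ioi u, Real.exp (-p * y) * W' y =
      p * (∫ y in Ioi u, Real.exp (-p * y) * W y) - Real.exp (-p * u) * W u := by
  obtain ⟨L, hL⟩ := hmono.exists_tendsto_atTop_of_abs_le hM
  have hcu : ContinuousWithinAt W (Ici u) u :=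
    (hcont u hu).mono (Ici_subset_Ici.2 hu)
  have h_int' : IntegrableOn W' (Ioi u) :=
    integrableOn_Ioi_deriv_of_nonneg hcu (fun x hx => hW' x (hu.trans_lt hx))
      (fun x hx => hmono.deriv_nonneg_of_hasDerivAt (hu.trans_lt hx) (hW' x (hu.trans_lt hx))) hL
  have h_int1 : IntegrableOn (fun y => Real.exp (-p * y) * W' y) (Ioi u) := by
    refine h_int'.bdd_mul (c := 1) (by fun_prop) ?_
    filter_upwards [ae_restrict_mem measurableSet_Ioi] with y hy
    rw [Real.norm_eq_abs, Real.abs_exp, Real.exp_le_one_iff]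
    nlinarith [mem_Ioi.1 hy]
  have h_int2 := (integrableOn_exp_neg_mul_of_abs_le hp hu hcont hM).const_mul p
  have hlim : Tendsto (fun y => Real.exp (-p * y) * W y) atTop (𝓝 0) := by
    have hexp : Tendsto (fun y => Real.exp (-p * y)) atTop (𝓝 0) :=
      Real.tendsto_exp_atBot.comp (tendsto_id.const_mul_atTop_of_neg (neg_lt_zero.2 hp))
    simpa using hexp.mul hL
  have hibp := integral_Ioi_of_hasDerivAt_of_tendsto
    (f := fun y => Real.exp (-p * y) * W y)
    (f' := fun y => Real.exp (-p * y) * W' y - p * (Real.exp (-p * y) * W y))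
    ((by fun_prop : Continuous fun y => Real.exp (-p * y)).continuousWithinAt.mul hcu)
    (fun y hy => by
      have he : HasDerivAt (fun y => Real.exp (-p * y)) (Real.exp (-p * y) * (-p * 1)) y :=
        ((hasDerivAt_id y).const_mul (-p)).exp
      convert! he.mul (hW' y (hu.trans_lt hy)) using 1
      ring)
    (h_int1.sub h_int2) hlim
  rw [integral_sub h_int1 h_int2, integral_const_mul] at hibp
  linarith

end LaplaceTransform

/-- Assume `q > 0` and `ψ′(0+) > α`, so that `Φ(q) > 0` and `q - αΦ(q) > 0`, and assume
moreover that `𝕎` is bounded and continuously differentiable on `(0,∞)` with derivative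
`𝕎′`. Then for every `u ≥ 0`,
`(Φ(q)/(q - αΦ(q))) e^{Φ(q)u} ( 1 - (q - αΦ(q)) ∫₀^u e^{-Φ(q)y} 𝕎(y) dy )
  = 𝕎(u) + ∫₀^∞ e^{-Φ(q)y} 𝕎′(y+u) dy`. -/
theorem exp_integral_derivative_identity
    (γ σ : ℝ) (hσ : 0 ≤ σ) (ν : Measure ℝ) (hν : IsLevyMeasure ν)
    (hbig : (∫⁻ z in Set.Ioi (1 : ℝ), ENNReal.ofReal z ∂ν) ≠ ⊤)
    (ψ'0 : ℝ) (hder : HasDerivWithinAt (levyPsi γ σ ν) ψ'0 (Set.Ici 0) 0)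
    (α : ℝ) (hα : 0 < α) (hprofit : α < ψ'0)
    (Wα0 Wα0' : ℝ → ℝ)
    (hWα0 : IsScaleFunction (fun l => levyPsi γ σ ν l - α * l) 0 0 Wα0)
    (hbd : ∃ M : ℝ, ∀ x : ℝ, |Wα0 x| ≤ M)
    (hW' : (∀ y : ℝ, 0 < y → HasDerivAt Wα0 (Wα0' y) y) ∧
      ContinuousOn Wα0' (Set.Ioi 0))
    (q : ℝ) (hq : 0 < q) :
    0 < levyPhi (levyPsi γ σ ν) q ∧
    0 < q - α * levyPhi (levyPsi γ σ ν) q ∧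
    ∀ u : ℝ, 0 ≤ u →
      levyPhi (levyPsi γ σ ν) q / (q - α * levyPhi (levyPsi γ σ ν) q) *
          Real.exp (levyPhi (levyPsi γ σ ν) q * u) *
          (1 - (q - α * levyPhi (levyPsi γ σ ν) q) *
            ∫ y in (0:ℝ)..u, Real.exp (-(levyPhi (levyPsi γ σ ν) q) * y) * Wα0 y) =
        Wα0 u +
          ∫ y in Set.Ioi (0 : ℝ),
            Real.exp (-(levyPhi (levyPsi γ σ ν) q) * y) * Wα0' (y + u) := by
  have hd : 0 < ψ'0 := hα.trans hprofit
  obtain ⟨hpos, hval, hle⟩ :=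
    levyPhi_spec (hν.convexOn_levyPsi γ σ) (levyPsi_zero γ σ ν) hder hd hq
  generalize levyPhi (levyPsi γ σ ν) q = p at *
  have hqp : 0 < q - α * p := by nlinarith
  refine ⟨hpos, hqp, fun u hu => ?_⟩
  obtain ⟨M, hM⟩ := hbd
  obtain ⟨-, hcont, hmono, htrans⟩ := hWα0
  have htransp := htrans p hpos
  simp only [hval, sub_zero] at htransp
  have h_int := integrableOn_exp_neg_mul_of_abs_le hpos le_rfl hcont hM
  have hsplit := setIntegral_union (Ioc_disjoint_Ioi le_rfl) measurableSet_Ioi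
    (h_int.mono_set (Ioc_subset_Ioi_self : Ioc 0 u ⊆ Ioi 0)) (h_int.mono_set (Ioi_subset_Ioi hu))
  rw [Ioc_union_Ioi_eq_Ioi hu, htransp, ← intervalIntegral.integral_of_le hu] at hsplit
  have hcancel : Real.exp (p * u) * Real.exp (-p * u) = 1 := by
    rw [← Real.exp_add]; simp
  have hshift : ∫ y in Ioi (0 : ℝ), Real.exp (-p * y) * Wα0' (y + u) =
      Real.exp (p * u) * ∫ y in Ioi u, Real.exp (-p * y) * Wα0' y := by
    rw [← setIntegral_Ioi_comp_add_right (fun y => Real.exp (-p * y) * Wα0' y),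
      ← integral_const_mul]
    refine integral_congr_ae (Eventually.of_forall fun y => ?_)
    beta_reduce
    rw [← mul_assoc, ← Real.exp_add]
    ring_nf
  rw [hshift, setIntegral_Ioi_exp_neg_mul_deriv hpos hu hcont hmono hM hW'.1]
  have htail : (∫ y in Ioi u, Real.exp (-p * y) * Wα0 y) =
      1 / (q - α * p) - ∫ y in (0 : ℝ)..u, Real.exp (-p * y) * Wα0 y := by
    linarith
  rw [htail]
  generalize (∫ y in (0 : ℝ)..u, Real.exp (-p * y) * Wα0 y) = I
  generalize q - α * p = D at hqp
  have hne := hqp.ne'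
  calc p / D * Real.exp (p * u) * (1 - D * I)
      = Wα0 u + (Real.exp (p * u) * (p * (1 / D - I)) - 1 * Wα0 u) := by
        field_simp
        ring
    _ = _ := by rw [← hcancel]; ring
end
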